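/- Let ν ∈ (−2,−1], let β be the power-law fragment daughter distribution with exponent ν, fix k₀ ∈ (|ν|−1,1), and let Φ be the collision kernel with exponents λ₁ ≤ λ₂ ≤ 1. Assume λ₁ < |ν|−1 and λ = λ₁+λ₂ < 1. Let u^in ∈ X_{k₀} ∩ X_{1+k₀} be nonnegative with M₁(u^in) > 0 and let T > 0. Then there exists no mass-conserving weak solution to the collision-induced fragmentation equation on [0,T). -/

import Mathlib

open MeasureTheory Set Filter
open scoped ENNReal

noncomputable section

/-- The `k`-th moment `M_k(g) = ∫₀^∞ x^k g(x) dx`. -/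
def Mk (k : ℝ) (g : ℝ → ℝ) : ℝ := ∫ x in Ioi (0:ℝ), x ^ k * g x

/-- Membership in the weighted space `X_k`. -/
def MemXk (k : ℝ) (g : ℝ → ℝ) : Prop :=
  MeasureTheory.IntegrableOn (fun x => x ^ k * g x) (Ioi (0:ℝ))

/-- The fragment daughter distribution built from `β_*` via the mass-transfer form
`β(x₃,x₁,x₂) = β_*(x₃,x₁,x₂)·1_{(0,x₁)}(x₃) + β_*(x₃,x₂,x₁)·1_{(0,x₂)}(x₃)`. -/
def betaOf (bs : ℝ → ℝ → ℝ → ℝ) (x₃ x₁ x₂ : ℝ) : ℝ :=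
  (if x₃ ∈ Ioo (0:ℝ) x₁ then bs x₃ x₁ x₂ else 0) +
  (if x₃ ∈ Ioo (0:ℝ) x₂ then bs x₃ x₂ x₁ else 0)

/-- The power-law `β_*(x₃,x₁,x₂) = (ν+2) x₃^ν x₁^{-ν-1} 1_{(0,x₁)}(x₃)`. -/
def betaPow (ν : ℝ) (x₃ x₁ x₂ : ℝ) : ℝ :=
  if x₃ ∈ Ioo (0:ℝ) x₁ then (ν + 2) * x₃ ^ ν * x₁ ^ (-ν - 1) else 0

/-- The collision kernel `Φ(x₁,x₂) = x₁^{λ₁} x₂^{λ₂} + x₂^{λ₁} x₁^{λ₂}`. -/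
def Phi (l₁ l₂ : ℝ) (x₁ x₂ : ℝ) : ℝ := x₁ ^ l₁ * x₂ ^ l₂ + x₂ ^ l₁ * x₁ ^ l₂

/-- `Υ_ς(x₁,x₂) = ∫₀^{x₁+x₂} ς(x₃) β(x₃,x₁,x₂) dx₃ - ς(x₁) - ς(x₂)`, where `β = betaOf bs`. -/
def Upsilon (bs : ℝ → ℝ → ℝ → ℝ) (ς : ℝ → ℝ) (x₁ x₂ : ℝ) : ℝ :=
  (∫ x₃ in Ioo (0:ℝ) (x₁ + x₂), ς x₃ * betaOf bs x₃ x₁ x₂) - ς x₁ - ς x₂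

/-- Assumptions on `β_*`: measurability, nonnegativity, local mass conservation, and the
non-integrability bounds `∫₀^{x₁} x₃^{k₀} β_*(x₃,x₁,x₂)^p dx₃ ≤ E_{k₀,p} x₁^{k₀+1-p}`
for `p ∈ [1,p₀]`, some `p₀ ∈ (1,1+k₀)`. -/
structure FragKernel (k₀ : ℝ) (bs : ℝ → ℝ → ℝ → ℝ) : Prop where
  meas : Measurable fun q : ℝ × ℝ × ℝ => bs q.1 q.2.1 q.2.2
  nonneg : ∀ x₃ x₁ x₂ : ℝ, 0 ≤ bs x₃ x₁ x₂
  mass : ∀ x₁ ∈ Ioi (0:ℝ), ∀ x₂ ∈ Ioi (0:ℝ),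
    ∫ x₃ in Ioo (0:ℝ) x₁, x₃ * bs x₃ x₁ x₂ = x₁
  bound : ∃ p₀ ∈ Ioo (1:ℝ) (1 + k₀), ∀ p ∈ Icc (1:ℝ) p₀, ∃ E : ℝ, 0 < E ∧
    ∀ x₁ ∈ Ioi (0:ℝ), ∀ x₂ ∈ Ioi (0:ℝ),
      ∫ x₃ in Ioo (0:ℝ) x₁, x₃ ^ k₀ * (bs x₃ x₁ x₂) ^ p ≤ E * x₁ ^ (k₀ + 1 - p)

/-- `ς(0) = 0` and `ς` is Hölder continuous with exponent `k₀` on `[0,∞)`. -/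
def HolderZero (k₀ : ℝ) (ς : ℝ → ℝ) : Prop :=
  ς 0 = 0 ∧ ∃ H : ℝ, ∀ a b : ℝ, 0 ≤ a → 0 ≤ b → |ς a - ς b| ≤ H * |a - b| ^ k₀

/-- `ς` is bounded on `[0,∞)`. -/
def BddOnNonneg (ς : ℝ → ℝ) : Prop := ∃ C : ℝ, ∀ x : ℝ, 0 ≤ x → |ς x| ≤ C

/-- A weak solution on `[0,T)` to the collision-induced fragmentation equation with
daughter distribution `betaOf bs` and collision kernel `K`. -/
structure IsWeakSolution (k₀ : ℝ) (bs : ℝ → ℝ → ℝ → ℝ) (K : ℝ → ℝ → ℝ)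
    (uin : ℝ → ℝ) (T : ℝ≥0∞) (u : ℝ → ℝ → ℝ) : Prop where
  meas : Measurable (Function.uncurry u)
  nonneg : ∀ t : ℝ, 0 ≤ t → ENNReal.ofReal t < T → ∀ x ∈ Ioi (0:ℝ), 0 ≤ u t x
  init : ∀ x ∈ Ioi (0:ℝ), u 0 x = uin x
  cont : ∀ g : ℝ → ℝ, Measurable g → (∃ C : ℝ, ∀ x : ℝ, |g x| ≤ C) →
    ContinuousOn (fun t => ∫ x in Ioi (0:ℝ), g x * (x ^ k₀ * u t x))
      {t : ℝ | 0 ≤ t ∧ ENNReal.ofReal t < T}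
  massBdd : ∃ C : ℝ, ∀ t : ℝ, 0 ≤ t → ENNReal.ofReal t < T →
    (∫⁻ x in Ioi (0:ℝ), ENNReal.ofReal (x * u t x)) ≤ ENNReal.ofReal C
  integ : ∀ t : ℝ, 0 < t → ENNReal.ofReal t < T →
    MeasureTheory.IntegrableOn
      (fun q : ℝ × ℝ × ℝ =>
        (q.2.1 ^ k₀ + q.2.2 ^ k₀) * K q.2.1 q.2.2 * u q.1 q.2.1 * u q.1 q.2.2)
      (Ioo (0:ℝ) t ×ˢ (Ioi (0:ℝ) ×ˢ Ioi (0:ℝ)))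
  weak : ∀ t : ℝ, 0 < t → ENNReal.ofReal t < T → ∀ ς : ℝ → ℝ,
    HolderZero k₀ ς → BddOnNonneg ς →
    ∫ x in Ioi (0:ℝ), ς x * u t x =
      (∫ x in Ioi (0:ℝ), ς x * uin x) +
      (1/2) * ∫ τ in Ioo (0:ℝ) t, ∫ x₁ in Ioi (0:ℝ), ∫ x₂ in Ioi (0:ℝ),
        Upsilon bs ς x₁ x₂ * K x₁ x₂ * u τ x₁ * u τ x₂

/-- Mass conservation on `[0,T)`. -/
def MassConserving (uin : ℝ → ℝ) (T : ℝ≥0∞) (u : ℝ → ℝ → ℝ) : Prop :=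
  ∀ t : ℝ, 0 ≤ t → ENNReal.ofReal t < T → Mk 1 (u t) = Mk 1 uin

/-- The formation term `F` with kernel `K`. -/
def Fform (bs : ℝ → ℝ → ℝ → ℝ) (K : ℝ → ℝ → ℝ) (v : ℝ → ℝ) (x₁ : ℝ) : ℝ :=
  (1/2) * ∫ x₂ in Ioi x₁, ∫ x₃ in Ioo (0:ℝ) x₂,
    betaOf bs x₁ (x₂ - x₃) x₃ * K (x₂ - x₃) x₃ * v (x₂ - x₃) * v x₃

/-- The loss term `L` with kernel `K`. -/
def Lform (K : ℝ → ℝ → ℝ) (v : ℝ → ℝ) (x₁ : ℝ) : ℝ :=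
  v x₁ * ∫ x₂ in Ioi (0:ℝ), K x₁ x₂ * v x₂

/-- The norm of `X_{k₀} ∩ X₁`, i.e. the `L¹` norm with weight `x^{k₀} + x`. -/
def N01 (k₀ : ℝ) (g : ℝ → ℝ) : ℝ := ∫ x in Ioi (0:ℝ), (x ^ k₀ + x) * |g x|

/-- The truncated collision kernel `Φ_n`. -/
def PhiTrunc (l₁ l₂ : ℝ) (n : ℕ) (x₁ x₂ : ℝ) : ℝ :=
  if x₁ ∈ Ioo ((n:ℝ)⁻¹) (n:ℝ) ∧ x₂ ∈ Ioo ((n:ℝ)⁻¹) (n:ℝ) then Phi l₁ l₂ x₁ x₂ else 0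

/-- `u` is a continuously differentiable curve in `X_{k₀} ∩ X₁` on `[0,∞)`, with `u(0) = v0`,
solving `∂ₜ u = F u - L u` in the strong (norm) sense; the derivative
`t ↦ F u(t) - L u(t)` is moreover continuous in the norm of `X_{k₀} ∩ X₁`. -/
def SolvesTrunc (k₀ : ℝ) (bs : ℝ → ℝ → ℝ → ℝ) (K : ℝ → ℝ → ℝ) (v0 : ℝ → ℝ)
    (u : ℝ → ℝ → ℝ) : Prop :=
  Measurable (Function.uncurry u) ∧
  (∀ x ∈ Ioi (0:ℝ), u 0 x = v0 x) ∧
  (∀ t : ℝ, 0 ≤ t → MemXk k₀ (u t) ∧ MemXk 1 (u t)) ∧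
  (∀ t : ℝ, 0 ≤ t →
    Tendsto (fun h : ℝ =>
        N01 k₀ (fun x => (u (t + h) x - u t x) / h - (Fform bs K (u t) x - Lform K (u t) x)))
      (nhdsWithin 0 {h : ℝ | h ≠ 0 ∧ 0 ≤ t + h}) (nhds 0)) ∧
  (∀ t₀ : ℝ, 0 ≤ t₀ →
    Tendsto (fun t : ℝ =>
        N01 k₀ (fun x =>
          (Fform bs K (u t) x - Lform K (u t) x) - (Fform bs K (u t₀) x - Lform K (u t₀) x)))
      (nhdsWithin t₀ (Ici (0:ℝ))) (nhds 0))

/-- Bundled data and standing assumptions of the paper. -/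
structure Setup where
  k₀ : ℝ
  l₁ : ℝ
  l₂ : ℝ
  bs : ℝ → ℝ → ℝ → ℝ
  E₁ : ℝ
  uin : ℝ → ℝ
  hk₀ : k₀ ∈ Ioo (0:ℝ) 1
  hl₁ : k₀ ≤ l₁
  hl₁₂ : l₁ ≤ l₂
  hl₂ : l₂ ≤ 1
  hβ : FragKernel k₀ bs
  hE₁pos : 0 < E₁
  hE₁ : ∀ x₁ ∈ Ioi (0:ℝ), ∀ x₂ ∈ Ioi (0:ℝ),
    ∫ x₃ in Ioo (0:ℝ) x₁, x₃ ^ k₀ * bs x₃ x₁ x₂ ≤ E₁ * x₁ ^ k₀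
  hmeas : Measurable uin
  hnn : ∀ x : ℝ, 0 ≤ uin x
  hXk₀ : MemXk k₀ uin
  hX1 : MemXk 1 uin
  hX1k₀ : MemXk (1 + k₀) uin
  hρ : 0 < Mk 1 uin

/-- Apply a function of the seven quantities `k₀, λ₁, λ₂, ρ, M_{k₀}(u^in), M_{k₀+1}(u^in), E_{k₀,1}`
to the data of a setup. -/
def app7 {α : Sort*} (f : ℝ → ℝ → ℝ → ℝ → ℝ → ℝ → ℝ → α) (S : Setup) : α :=
  f S.k₀ S.l₁ S.l₂ (Mk 1 S.uin) (Mk S.k₀ S.uin) (Mk (S.k₀ + 1) S.uin) S.E₁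

/-- A nonnegative `C¹` solution of the truncated equation with truncated initial condition,
satisfying the mass bound and the `(k₀+1)`-moment bound. -/
def IsTruncSolution (S : Setup) (n : ℕ) (u : ℝ → ℝ → ℝ) : Prop :=
  SolvesTrunc S.k₀ S.bs (PhiTrunc S.l₁ S.l₂ n) ((Ioo (0:ℝ) (2 * n)).indicator S.uin) u ∧
  (∀ t : ℝ, 0 ≤ t → ∀ x ∈ Ioi (0:ℝ), 0 ≤ u t x) ∧
  (∀ t : ℝ, 0 ≤ t → Mk 1 (u t) ≤ Mk 1 S.uin) ∧
  (∀ t : ℝ, 0 ≤ t → Mk (S.k₀ + 1) (u t) ≤ Mk (S.k₀ + 1) S.uin)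

end

noncomputable section

/-- Test function. -/
def sig (L a x : ℝ) : ℝ := min (x * L) (min (x ^ a) 1)

lemma sig_nonneg {L a x : ℝ} (hL : 0 < L) (hx : 0 ≤ x) : 0 ≤ sig L a x := by
  unfold sig
  refine le_min (by positivity) (le_min (by positivity) (by norm_num))

lemma sig_le_lin {L a x : ℝ} : sig L a x ≤ x * L := min_le_left _ _

lemma sig_le_pow {L a x : ℝ} : sig L a x ≤ x ^ a := (min_le_right _ _).trans (min_le_left _ _)

lemma sig_le_one {L a x : ℝ} : sig L a x ≤ 1 := (min_le_right _ _).trans (min_le_right _ _)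

lemma sig_mono {L a x y : ℝ} (hL : 0 < L) (ha : 0 ≤ a) (hx : 0 ≤ x) (hxy : x ≤ y) :
    sig L a x ≤ sig L a y := by
  unfold sig
  gcongr

lemma sig_mul {L a x y : ℝ} (ha1 : a < 1) (hy : 0 < y) (hyx : y ≤ x) :
    sig L a x * y ≤ sig L a y * x := by
  have hx : 0 < x := hy.trans_le hyx
  have e : sig L a y * x = min (y * L * x) (min (y ^ a * x) (1 * x)) := by
    unfold sig
    rw [min_mul_of_nonneg _ _ hx.le, min_mul_of_nonneg _ _ hx.le]
  rw [e]
  refine le_min ?_ (le_min ?_ ?_)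
  · have := mul_le_mul_of_nonneg_right (sig_le_lin (L := L) (a := a) (x := x)) hy.le
    linarith
  · have h1 := mul_le_mul_of_nonneg_right (sig_le_pow (L := L) (a := a) (x := x)) hy.le
    have h2 : y ^ (1 - a) ≤ x ^ (1 - a) := Real.rpow_le_rpow hy.le hyx (by linarith)
    have hy' : y = y ^ a * y ^ (1 - a) := by
      rw [← Real.rpow_add hy]; simp
    have hx' : x = x ^ a * x ^ (1 - a) := by
      rw [← Real.rpow_add hx]; simp
    calc sig L a x * y ≤ x ^ a * y := h1
      _ = x ^ a * (y ^ a * y ^ (1 - a)) := by rw [← hy']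
      _ ≤ x ^ a * (y ^ a * x ^ (1 - a)) := by gcongr
      _ = y ^ a * (x ^ a * x ^ (1 - a)) := by ring
      _ = y ^ a * x := by rw [← hx']
  · have := mul_le_mul_of_nonneg_right (sig_le_one (L := L) (a := a) (x := x)) hy.le
    linarith

lemma sig_zero {L a : ℝ} : sig L a 0 = 0 := by
  unfold sig
  rw [zero_mul]
  exact min_eq_left (le_min (Real.zero_rpow_nonneg a) zero_le_one)

lemma sig_lip {L a x y : ℝ} (hL : 0 < L) (ha : 0 ≤ a) (ha1 : a < 1) (hx : 0 ≤ x) (hxy : x ≤ y) :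
    |sig L a y - sig L a x| ≤ L * (y - x) := by
  rw [abs_of_nonneg (sub_nonneg.2 (sig_mono hL ha hx hxy))]
  rcases hx.eq_or_lt with rfl | hx
  · rw [sig_zero]
    have := sig_le_lin (L := L) (a := a) (x := y)
    linarith
  · have h1 := sig_mul (L := L) ha1 hx hxy
    have h2 := sig_le_lin (L := L) (a := a) (x := x)
    have : (sig L a y - sig L a x) * x ≤ L * (y - x) * x := by
      nlinarith [mul_le_mul_of_nonneg_right h2 (sub_nonneg.2 hxy)]
    exact le_of_mul_le_mul_right this hx

lemma sig_holder_aux {L a k x y : ℝ} (hL : 0 < L) (ha : 0 ≤ a) (ha1 : a < 1) (hk : 0 < k)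
    (hk1 : k < 1) (hx : 0 ≤ x) (hxy : x ≤ y) :
    |sig L a y - sig L a x| ≤ (max L 1) * |y - x| ^ k := by
  rw [abs_of_nonneg (sub_nonneg.2 hxy)]
  rcases le_total (y - x) 1 with h | h
  · have h0 : 0 ≤ y - x := sub_nonneg.2 hxy
    have h1 := sig_lip hL ha ha1 hx hxy
    have h2 : y - x ≤ (y - x) ^ k := Real.self_le_rpow_of_le_one h0 h hk1.le
    calc _ ≤ L * (y - x) := h1
      _ ≤ (max L 1) * (y - x) ^ k := by
        gcongr
        exact le_max_left _ _
  · have h1 : |sig L a y - sig L a x| ≤ 1 := by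
      have := sig_nonneg (a := a) hL hx
      have := sig_nonneg (a := a) hL (hx.trans hxy)
      have := sig_le_one (L := L) (a := a) (x := x)
      have := sig_le_one (L := L) (a := a) (x := y)
      rw [abs_le]; constructor <;> linarith
    have h2 : 1 ≤ (y - x) ^ k := Real.one_le_rpow h hk.le
    have h3 : (1:ℝ) ≤ max L 1 := le_max_right _ _
    nlinarith

lemma sig_holder {L a k : ℝ} (hL : 0 < L) (ha : 0 ≤ a) (ha1 : a < 1) (hk : 0 < k)
    (hk1 : k < 1) : HolderZero k (sig L a) := by
  refine ⟨sig_zero, max L 1, fun x y hx hy => ?_⟩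
  rcases le_total x y with h | h
  · rw [abs_sub_comm, abs_sub_comm x y]
    exact sig_holder_aux hL ha ha1 hk hk1 hx h
  · exact sig_holder_aux hL ha ha1 hk hk1 hy h

lemma sig_le_hold {L a k x : ℝ} (hL : 0 < L) (ha : 0 ≤ a) (ha1 : a < 1) (hk : 0 < k)
    (hk1 : k < 1) (hx : 0 ≤ x) : sig L a x ≤ (max L 1) * x ^ k := by
  have := sig_holder_aux hL ha ha1 hk hk1 le_rfl hx
  rw [sig_zero, sub_zero, sub_zero, abs_of_nonneg hx] at this
  exact (le_abs_self _).trans this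

lemma sig_bdd {L a : ℝ} (hL : 0 < L) : BddOnNonneg (sig L a) :=
  ⟨1, fun x hx => by rw [abs_of_nonneg (sig_nonneg hL hx)]; exact sig_le_one⟩

lemma sig_meas {L a : ℝ} : Measurable (sig L a) := by
  unfold sig
  fun_prop

lemma intOn_rpow {p b : ℝ} (hp : -1 < p) :
    IntegrableOn (fun x : ℝ => x ^ p) (Ioo 0 b) := by
  rcases le_total b 0 with hb | hb
  · rw [Ioo_eq_empty (by linarith)]; exact integrableOn_empty
  · have := (intervalIntegral.intervalIntegrable_rpow' (a := 0) (b := b) hp)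
    rw [intervalIntegrable_iff_integrableOn_Ioo_of_le hb] at this
    exact this

lemma int_rpow {p b : ℝ} (hp : -1 < p) (hb : 0 ≤ b) :
    ∫ x in Ioo (0:ℝ) b, x ^ p = b ^ (p + 1) / (p + 1) := by
  rw [← integral_Ioc_eq_integral_Ioo, ← intervalIntegral.integral_of_le hb,
    integral_rpow (Or.inl hp), Real.zero_rpow (by linarith), sub_zero]

/-- Primitive. -/
def GG (L ν b : ℝ) : ℝ := ∫ x in Ioo (0:ℝ) b, sig L (-ν - 1) x * x ^ ν

lemma gg_int {L ν b : ℝ} (hL : 0 < L) (hν : -2 < ν) :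
    IntegrableOn (fun x => sig L (-ν - 1) x * x ^ ν) (Ioo 0 b) := by
  have h := (intOn_rpow (p := ν + 1) (b := b) (by linarith)).const_mul L
  refine Integrable.mono' h ?_ ?_
  · exact (sig_meas.mul (by fun_prop)).aestronglyMeasurable
  · filter_upwards [ae_restrict_mem measurableSet_Ioo] with x hx
    have hx0 := hx.1
    have h0 := sig_nonneg (L := L) (a := -ν - 1) hL hx0.le
    rw [Real.norm_of_nonneg (by positivity), Real.rpow_add hx0, Real.rpow_one]
    have := sig_le_lin (L := L) (a := -ν - 1) (x := x)
    calc _ ≤ (x * L) * x ^ ν := by gcongr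
      _ = _ := by ring

lemma gg_mono {L ν : ℝ} (hL : 0 < L) (hν : -2 < ν) : Monotone (GG L ν) := by
  intro b c hbc
  refine setIntegral_mono_set (gg_int hL hν) ?_ (Ioo_subset_Ioo le_rfl hbc).eventuallyLE
  filter_upwards [ae_restrict_mem measurableSet_Ioo] with x hx
  have hx0 := hx.1
  have h0 := sig_nonneg (L := L) (a := -ν - 1) hL hx0.le
  simp only [Pi.zero_apply]
  positivity

lemma gg_ge {L ν b : ℝ} (hL : 0 < L) (hν : -2 < ν) (hb : 0 < b) :
    sig L (-ν - 1) b ≤ (ν + 2) * b ^ (-ν - 1) * GG L ν b := by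
  have h1 : sig L (-ν - 1) b / b * (b ^ (ν + 1 + 1) / (ν + 1 + 1)) ≤ GG L ν b := by
    rw [← int_rpow (by linarith) hb.le, ← integral_const_mul]
    refine setIntegral_mono_on ((intOn_rpow (by linarith)).const_mul _) (gg_int hL hν)
      measurableSet_Ioo fun x hx => ?_
    have hx0 := hx.1
    have h2 := sig_mul (L := L) (a := -ν - 1) (by linarith) hx0 hx.2.le
    rw [Real.rpow_add hx0, Real.rpow_one, div_mul_eq_mul_div, div_le_iff₀ hb]
    have : 0 ≤ x ^ ν := by positivity
    nlinarith
  have hν2 : 0 < ν + 2 := by linarith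
  have h3 : 0 ≤ (ν + 2) * b ^ (-ν - 1) := by positivity
  refine le_trans (le_of_eq ?_) (mul_le_mul_of_nonneg_left h1 h3)
  have e : ν + 1 + 1 = ν + 2 := by ring
  rw [e]
  have e2 : b ^ (-ν - 1) * b ^ (ν + 2) = b := by
    rw [← Real.rpow_add hb]
    have : -ν - 1 + (ν + 2) = 1 := by ring
    rw [this, Real.rpow_one]
  calc sig L (-ν - 1) b = sig L (-ν - 1) b / b * b := by field_simp
    _ = sig L (-ν - 1) b / b * (b ^ (-ν - 1) * b ^ (ν + 2)) := by rw [e2]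
    _ = _ := by field_simp

lemma gg_le {L ν k b : ℝ} (hL : 0 < L) (hν : -2 < ν) (hν1 : ν ≤ -1) (hk : -ν - 1 < k)
    (hk1 : k < 1) (hb : 0 < b) :
    (ν + 2) * b ^ (-ν - 1) * GG L ν b ≤ (ν + 2) * (max L 1 / (k + ν + 1)) * b ^ k := by
  have h1 : GG L ν b ≤ max L 1 * (b ^ (k + ν + 1) / (k + ν + 1)) := by
    rw [← int_rpow (by linarith) hb.le, ← integral_const_mul]
    refine setIntegral_mono_on (gg_int hL hν) ((intOn_rpow (by linarith)).const_mul _)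
      measurableSet_Ioo fun x hx => ?_
    have hx0 := hx.1
    have h2 := sig_le_hold (L := L) (a := -ν - 1) (k := k) hL (by linarith) (by linarith)
      (by linarith) hk1 hx0.le
    rw [Real.rpow_add hx0, ← mul_assoc]
    gcongr
  have hν2 : 0 < ν + 2 := by linarith
  have h3 : 0 ≤ (ν + 2) * b ^ (-ν - 1) := by positivity
  refine (mul_le_mul_of_nonneg_left h1 h3).trans (le_of_eq ?_)
  have e2 : b ^ (-ν - 1) * b ^ (k + ν + 1) = b ^ k := by
    rw [← Real.rpow_add hb]
    congr 1; ring
  rw [← e2]; ring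

lemma gg_log {ν b : ℝ} (n : ℕ) (hν : -2 < ν) (hν1 : ν ≤ -1) (hb : 0 < b)
    (hn : Real.exp (-n) ≤ min b 1) :
    n + Real.log (min b 1) ≤ GG (Real.exp ((ν + 2) * n)) ν b := by
  set m := min b 1 with hm
  have hm0 : 0 < m := lt_min hb one_pos
  have he := Real.exp_pos (-(n:ℝ))
  have h1 : ∫ x in Ioo (Real.exp (-n)) m, x⁻¹ = n + Real.log m := by
    rw [← integral_Ioc_eq_integral_Ioo, ← intervalIntegral.integral_of_le hn,
      integral_inv_of_pos he hm0, Real.log_div hm0.ne' he.ne', Real.log_exp]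
    ring
  rw [← h1]
  have hsub : Ioo (Real.exp (-n)) m ⊆ Ioo 0 b :=
    Ioo_subset_Ioo he.le (min_le_left _ _)
  have hI := gg_int (L := Real.exp ((ν + 2) * n)) (b := b) (Real.exp_pos _) hν
  have h2 : ∀ x ∈ Ioo (Real.exp (-n)) m,
      sig (Real.exp ((ν + 2) * n)) (-ν - 1) x * x ^ ν ≥ x⁻¹ := by
    intro x hx
    have hx0 : 0 < x := he.trans hx.1
    have hx1 : x ≤ 1 := hx.2.le.trans (min_le_right _ _)
    have hs : x ^ (-ν - 1) ≤ sig (Real.exp ((ν + 2) * n)) (-ν - 1) x := by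
      refine le_min ?_ (le_min le_rfl (Real.rpow_le_one hx0.le hx1 (by linarith)))
      have e : -ν - 1 = 1 + -(ν + 2) := by ring
      rw [e, Real.rpow_add hx0, Real.rpow_one]
      refine mul_le_mul_of_nonneg_left ?_ hx0.le
      have h3 := Real.rpow_le_rpow_of_nonpos he hx.1.le (show -(ν + 2) ≤ 0 by linarith)
      refine h3.trans (le_of_eq ?_)
      rw [← Real.exp_mul]
      congr 1; ring
    have e : x⁻¹ = x ^ (-ν - 1) * x ^ ν := by
      rw [← Real.rpow_add hx0, ← Real.rpow_neg_one]
      congr 1; ring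
    rw [e, ge_iff_le]
    gcongr
  have h4 : IntegrableOn (fun x : ℝ => x⁻¹) (Ioo (Real.exp (-n)) m) := by
    refine Integrable.mono' (hI.mono_set hsub) (by fun_prop) ?_
    filter_upwards [ae_restrict_mem measurableSet_Ioo] with x hx
    have hx0 : 0 < x := he.trans hx.1
    rw [Real.norm_of_nonneg (by positivity)]
    exact h2 x hx
  refine (setIntegral_mono_on h4 (hI.mono_set hsub) measurableSet_Ioo h2).trans ?_
  refine setIntegral_mono_set hI ?_ hsub.eventuallyLE
  filter_upwards [ae_restrict_mem measurableSet_Ioo] with x hx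
  have hx0 := hx.1
  have h0 := sig_nonneg (L := Real.exp ((ν + 2) * n)) (a := -ν - 1) (Real.exp_pos _) hx0.le
  simp only [Pi.zero_apply]
  positivity

lemma ups_eq {L ν x y : ℝ} (hL : 0 < L) (hν : -2 < ν) (hx : 0 < x) (hy : 0 < y) :
    Upsilon (betaPow ν) (sig L (-ν - 1)) x y =
      ((ν + 2) * x ^ (-ν - 1) * GG L ν x - sig L (-ν - 1) x) +
      ((ν + 2) * y ^ (-ν - 1) * GG L ν y - sig L (-ν - 1) y) := by
  have key : ∀ z, 0 < z → z ≤ x + y →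
      IntegrableOn ((Ioo 0 z).indicator
        (fun w => (ν + 2) * z ^ (-ν - 1) * (sig L (-ν - 1) w * w ^ ν))) (Ioo 0 (x + y)) ∧
      ∫ w in Ioo 0 (x + y), (Ioo 0 z).indicator
        (fun w => (ν + 2) * z ^ (-ν - 1) * (sig L (-ν - 1) w * w ^ ν)) w =
        (ν + 2) * z ^ (-ν - 1) * GG L ν z := by
    intro z hz hzx
    constructor
    · refine IntegrableOn.indicator ?_ measurableSet_Ioo
      exact (gg_int hL hν).const_mul _
    · rw [setIntegral_indicator measurableSet_Ioo,
        inter_eq_right.2 (Ioo_subset_Ioo le_rfl hzx), integral_const_mul]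
      rfl
  obtain ⟨i1, e1⟩ := key x hx (by linarith)
  obtain ⟨i2, e2⟩ := key y hy (by linarith)
  have : (∫ w in Ioo (0:ℝ) (x + y), sig L (-ν - 1) w * betaOf (betaPow ν) w x y) =
      (ν + 2) * x ^ (-ν - 1) * GG L ν x + (ν + 2) * y ^ (-ν - 1) * GG L ν y := by
    rw [← e1, ← e2, ← integral_add i1 i2]
    congr 1
    ext w
    unfold betaOf betaPow
    by_cases h1 : w ∈ Ioo 0 x <;> by_cases h2 : w ∈ Ioo 0 y <;>
      simp [h1, h2, -mem_Ioo] <;> ring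
  unfold Upsilon
  rw [this]; ring

lemma phi_pos {l₁ l₂ x y : ℝ} (hx : 0 < x) (hy : 0 < y) : 0 < Phi l₁ l₂ x y := by
  unfold Phi; positivity

lemma ups_nonneg {L ν x y : ℝ} (hL : 0 < L) (hν : -2 < ν) (hx : 0 < x) (hy : 0 < y) :
    0 ≤ Upsilon (betaPow ν) (sig L (-ν - 1)) x y := by
  rw [ups_eq hL hν hx hy]
  have := gg_ge hL hν hx
  have := gg_ge hL hν hy
  linarith

lemma ups_le {L ν k x y : ℝ} (hL : 0 < L) (hν : -2 < ν) (hν1 : ν ≤ -1) (hk : -ν - 1 < k)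
    (hk1 : k < 1) (hx : 0 < x) (hy : 0 < y) :
    Upsilon (betaPow ν) (sig L (-ν - 1)) x y ≤
      (ν + 2) * (max L 1 / (k + ν + 1)) * (x ^ k + y ^ k) := by
  rw [ups_eq hL hν hx hy]
  have := gg_le hL hν hν1 hk hk1 hx
  have := gg_le hL hν hν1 hk hk1 hy
  have := sig_nonneg (a := -ν - 1) hL hx.le
  have := sig_nonneg (a := -ν - 1) hL hy.le
  linarith

lemma ups_tendsto {ν x y : ℝ} (hν : -2 < ν) (hν1 : ν ≤ -1) (hx : 0 < x) (hy : 0 < y) :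
    Tendsto (fun n : ℕ => Upsilon (betaPow ν) (sig (Real.exp ((ν + 2) * n)) (-ν - 1)) x y)
      atTop atTop := by
  have hc : 0 < (ν + 2) * x ^ (-ν - 1) := mul_pos (by linarith) (by positivity)
  have h1 : Tendsto (fun n : ℕ => (ν + 2) * x ^ (-ν - 1) * (n + Real.log (min x 1)) + (-1))
      atTop atTop := by
    refine tendsto_atTop_add_const_right _ _ (Tendsto.const_mul_atTop hc ?_)
    exact tendsto_atTop_add_const_right _ _ tendsto_natCast_atTop_atTop
  refine tendsto_atTop_mono' _ ?_ h1
  have h2 : Tendsto (fun n : ℕ => Real.exp (-(n:ℝ))) atTop (nhds 0) :=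
    Real.tendsto_exp_neg_atTop_nhds_zero.comp tendsto_natCast_atTop_atTop
  filter_upwards [h2.eventually_le_const (lt_min hx one_pos)] with n hn
  rw [ups_eq (Real.exp_pos _) hν hx hy]
  have h3 := mul_le_mul_of_nonneg_left (gg_log n hν hν1 hx hn) hc.le
  have h4 := gg_ge (Real.exp_pos ((ν + 2) * n)) hν hy
  have h5 := sig_le_one (L := Real.exp ((ν + 2) * n)) (a := -ν - 1) (x := x)
  linarith

lemma gg_meas {L ν : ℝ} (hL : 0 < L) (hν : -2 < ν) : Measurable (GG L ν) :=
  (gg_mono hL hν).measurable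

/-- product domain -/
abbrev Dom (t : ℝ) : Set (ℝ × ℝ × ℝ) := Ioo (0:ℝ) t ×ˢ (Ioi (0:ℝ) ×ˢ Ioi (0:ℝ))

lemma dom_meas (t : ℝ) : MeasurableSet (Dom t) :=
  measurableSet_Ioo.prod (measurableSet_Ioi.prod measurableSet_Ioi)

lemma dom_vol (t : ℝ) : (volume.restrict (Dom t) : Measure (ℝ × ℝ × ℝ)) =
    (volume.restrict (Ioo (0:ℝ) t)).prod
      ((volume.restrict (Ioi (0:ℝ))).prod (volume.restrict (Ioi (0:ℝ)))) := by
  rw [Measure.prod_restrict, Measure.prod_restrict]; rfl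

theorem nonex_core
    (ν k₀ l₁ l₂ : ℝ) (hν : -2 < ν) (hν1 : ν ≤ -1)
    (hk : -ν - 1 < k₀) (hk1 : k₀ < 1) (hl₁ : l₁ < -ν - 1)
    (uin : ℝ → ℝ) (hnn : ∀ x : ℝ, 0 ≤ uin x)
    (hρ : 0 < Mk 1 uin)
    (T : ℝ) (hT : 0 < T) (u : ℝ → ℝ → ℝ)
    (hu : IsWeakSolution k₀ (betaPow ν) (Phi l₁ l₂) uin (ENNReal.ofReal T) u)
    (hm : MassConserving uin (ENNReal.ofReal T) u) : False := by
  have hlt : ∀ t : ℝ, t < T → ENNReal.ofReal t < ENNReal.ofReal T := fun t ht =>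
    (ENNReal.ofReal_lt_ofReal_iff hT).2 ht
  -- positivity
  have hpos : ∀ τ : ℝ, 0 ≤ τ → τ < T → ∀ P : ℝ → Prop,
      (∀ᵐ x ∂(volume.restrict (Ioi (0:ℝ))), P x) → ∃ x, 0 < x ∧ P x ∧ 0 < u τ x := by
    intro τ h0 h1 P hP
    by_contra hcon
    push Not at hcon
    have hz : Mk 1 (u τ) = 0 := by
      unfold Mk
      refine integral_eq_zero_of_ae ?_
      filter_upwards [hP, ae_restrict_mem measurableSet_Ioi] with x hx hx0
      have h2 := hcon x hx0 hx
      have h3 := hu.nonneg τ h0 (hlt τ h1) x hx0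
      simp [le_antisymm h2 h3]
    rw [hm τ h0 (hlt τ h1)] at hz
    exact hρ.ne' hz
  have hM1 : ∀ τ : ℝ, 0 ≤ τ → τ < T → IntegrableOn (fun x => x ^ (1:ℝ) * u τ x) (Ioi 0) := by
    intro τ h0 h1
    refine Integrable.of_integral_ne_zero ?_
    have := hm τ h0 (hlt τ h1)
    unfold Mk at this hρ
    rw [this]; exact hρ.ne'
  -- choose t
  obtain ⟨t, ht0, htT, htI⟩ : ∃ t, 0 < t ∧ t < T ∧
      IntegrableOn (fun x => x ^ (-ν - 1) * u t x) (Ioi 0) := by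
    have hi := hu.integ (T/2) (by linarith) (hlt _ (by linarith))
    have hi' : Integrable _ (volume.restrict (Dom (T/2))) := hi
    rw [dom_vol] at hi'
    have h1 := hi'.prod_right_ae
    have : (ae (volume.restrict (Ioo (0:ℝ) (T/2)))).NeBot := by
      rw [ae_restrict_neBot, Real.volume_Ioo]
      simp [hT]
    obtain ⟨t, ht, htm⟩ := (h1.and (ae_restrict_mem measurableSet_Ioo)).exists
    have ht0 : 0 < t := htm.1
    have htT : t < T := by linarith [htm.2]
    refine ⟨t, ht0, htT, ?_⟩
    obtain ⟨x, hx0, hx, hux⟩ := hpos t ht0.le htT _ ht.prod_right_ae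
    have hl : IntegrableOn (fun y => y ^ l₁ * u t y) (Ioi 0) := by
      have hc : 0 < x ^ k₀ * x ^ l₂ * u t x := by positivity
      refine Integrable.mono' (hx.const_mul (x ^ k₀ * x ^ l₂ * u t x)⁻¹) ?_ ?_
      · have := hu.meas.of_uncurry_left (x := t)
        exact (Measurable.mul (by fun_prop) this).aestronglyMeasurable
      · filter_upwards [ae_restrict_mem measurableSet_Ioi] with y hy
        have hy0 : 0 < y := hy
        have huy := hu.nonneg t ht0.le (hlt t htT) y hy
        rw [Real.norm_of_nonneg (by positivity), inv_mul_eq_div, le_div_iff₀ hc]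
        simp only [Phi]
        have e : (x ^ k₀ + y ^ k₀) * (x ^ l₁ * y ^ l₂ + y ^ l₁ * x ^ l₂) * u t x * u t y =
          y ^ l₁ * u t y * (x ^ k₀ * x ^ l₂ * u t x) +
          (x ^ k₀ * (x ^ l₁ * y ^ l₂) + y ^ k₀ * (x ^ l₁ * y ^ l₂ + y ^ l₁ * x ^ l₂))
            * u t x * u t y := by ring
        rw [e]
        exact le_add_of_nonneg_right (by positivity)
    refine Integrable.mono' (hl.add (hM1 t ht0.le htT)) ?_ ?_
    · have := hu.meas.of_uncurry_left (x := t)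
      exact (Measurable.mul (by fun_prop) this).aestronglyMeasurable
    · filter_upwards [ae_restrict_mem measurableSet_Ioi] with y hy
      have hy0 : 0 < y := hy
      have huy := hu.nonneg t ht0.le (hlt t htT) y hy
      rw [Real.norm_of_nonneg (by positivity)]
      simp only [Pi.add_apply]
      rw [← add_mul]
      refine mul_le_mul_of_nonneg_right ?_ huy
      rcases le_total y 1 with h | h
      · have := Real.rpow_le_rpow_of_exponent_ge hy0 h hl₁.le
        exact le_add_of_le_of_nonneg this (by positivity)
      · have := Real.rpow_le_rpow_of_exponent_le h (show -ν - 1 ≤ 1 by linarith)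
        exact le_add_of_nonneg_of_le (by positivity) this
  -- the integrands
  set L : ℕ → ℝ := fun n => Real.exp ((ν + 2) * n) with hLdef
  have hL : ∀ n, 0 < L n := fun n => Real.exp_pos _
  set F : ℕ → ℝ × ℝ × ℝ → ℝ := fun n q =>
    Upsilon (betaPow ν) (sig (L n) (-ν - 1)) q.2.1 q.2.2 * Phi l₁ l₂ q.2.1 q.2.2
      * u q.1 q.2.1 * u q.1 q.2.2 with hF
  have hmemu : ∀ q ∈ Dom t, 0 < q.2.1 ∧ 0 < q.2.2 ∧ 0 ≤ u q.1 q.2.1 ∧ 0 ≤ u q.1 q.2.2 := by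
    rintro ⟨τ, x, y⟩ ⟨hτ, hx, hy⟩
    have hτ0 : 0 ≤ τ := hτ.1.le
    have hτT : τ < T := lt_trans hτ.2 htT
    exact ⟨hx, hy, hu.nonneg τ hτ0 (hlt τ hτT) x hx, hu.nonneg τ hτ0 (hlt τ hτT) y hy⟩
  have hFnn : ∀ n, ∀ q ∈ Dom t, 0 ≤ F n q := by
    intro n q hq
    obtain ⟨hx, hy, h1, h2⟩ := hmemu q hq
    have := ups_nonneg (hL n) hν hx hy
    have := (phi_pos (l₁ := l₁) (l₂ := l₂) hx hy).le
    simp only [hF]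
    positivity
  have hu1 : Measurable fun q : ℝ × ℝ × ℝ => u q.1 q.2.1 :=
    hu.meas.comp (measurable_fst.prodMk measurable_snd.fst)
  have hu2 : Measurable fun q : ℝ × ℝ × ℝ => u q.1 q.2.2 :=
    hu.meas.comp (measurable_fst.prodMk measurable_snd.snd)
  have hFm : ∀ n, AEMeasurable (F n) (volume.restrict (Dom t)) := by
    intro n
    have hg : Measurable (GG (L n) ν) := gg_meas (hL n) hν
    have hs : Measurable (sig (L n) (-ν - 1)) := sig_meas
    have hmm : Measurable fun q : ℝ × ℝ × ℝ =>
      (((ν + 2) * q.2.1 ^ (-ν - 1) * GG (L n) ν q.2.1 - sig (L n) (-ν - 1) q.2.1) +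
      ((ν + 2) * q.2.2 ^ (-ν - 1) * GG (L n) ν q.2.2 - sig (L n) (-ν - 1) q.2.2))
        * Phi l₁ l₂ q.2.1 q.2.2 * u q.1 q.2.1 * u q.1 q.2.2 := by
      have g1 : Measurable fun q : ℝ × ℝ × ℝ => GG (L n) ν q.2.1 := hg.comp measurable_snd.fst
      have g2 : Measurable fun q : ℝ × ℝ × ℝ => GG (L n) ν q.2.2 := hg.comp measurable_snd.snd
      have s1 : Measurable fun q : ℝ × ℝ × ℝ => sig (L n) (-ν - 1) q.2.1 :=
        hs.comp measurable_snd.fst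
      have s2 : Measurable fun q : ℝ × ℝ × ℝ => sig (L n) (-ν - 1) q.2.2 :=
        hs.comp measurable_snd.snd
      refine Measurable.mul (Measurable.mul (Measurable.mul (Measurable.add
        (Measurable.sub (Measurable.mul (by fun_prop) g1) s1)
        (Measurable.sub (Measurable.mul (by fun_prop) g2) s2)) ?_) hu1) hu2
      unfold Phi
      fun_prop
    refine hmm.aemeasurable.congr ?_
    filter_upwards [ae_restrict_mem (dom_meas t)] with q hq
    obtain ⟨hx, hy, h1, h2⟩ := hmemu q hq
    simp only [hF]
    rw [ups_eq (hL n) hν hx hy]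
  have hFi : ∀ n, Integrable (F n) (volume.restrict (Dom t)) := by
    intro n
    have hi := hu.integ t ht0 (hlt _ htT)
    refine Integrable.mono' (hi.const_mul ((ν + 2) * (max (L n) 1 / (k₀ + ν + 1))))
      (hFm n).aestronglyMeasurable ?_
    filter_upwards [ae_restrict_mem (dom_meas t)] with q hq
    rw [Real.norm_of_nonneg (hFnn n q hq)]
    obtain ⟨hx, hy, h1, h2⟩ := hmemu q hq
    have h3 := ups_le (hL n) hν hν1 hk hk1 hx hy
    have h4 := (phi_pos (l₁ := l₁) (l₂ := l₂) hx hy).le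
    simp only [hF]
    rw [← mul_assoc, ← mul_assoc, ← mul_assoc]
    gcongr
  set C : ℝ := ∫ x in Ioi (0:ℝ), x ^ (-ν - 1) * u t x with hC
  have hbound : ∀ n, ∫ q in Dom t, F n q ≤ 2 * C := by
    intro n
    have hw := hu.weak t ht0 (hlt _ htT) (sig (L n) (-ν - 1))
      (sig_holder (hL n) (by linarith) (by linarith) (by linarith) hk1) (sig_bdd (hL n))
    have e : ∫ q in Dom t, F n q = ∫ τ in Ioo (0:ℝ) t, ∫ x₁ in Ioi (0:ℝ), ∫ x₂ in Ioi (0:ℝ),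
        Upsilon (betaPow ν) (sig (L n) (-ν - 1)) x₁ x₂ * Phi l₁ l₂ x₁ x₂ * u τ x₁ * u τ x₂ := by
      have hi := hFi n
      rw [dom_vol] at hi ⊢
      rw [integral_prod _ hi]
      refine integral_congr_ae ?_
      filter_upwards [hi.prod_right_ae] with τ hτ
      rw [integral_prod _ hτ]
    rw [← e] at hw
    have h1 : 0 ≤ ∫ x in Ioi (0:ℝ), sig (L n) (-ν - 1) x * uin x :=
      setIntegral_nonneg measurableSet_Ioi fun x hx =>
        mul_nonneg (sig_nonneg (hL n) (le_of_lt hx)) (hnn x)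
    have h2 : ∫ x in Ioi (0:ℝ), sig (L n) (-ν - 1) x * u t x ≤ C := by
      refine integral_mono_of_nonneg ?_ htI ?_
      · filter_upwards [ae_restrict_mem measurableSet_Ioi] with x hx
        exact mul_nonneg (sig_nonneg (hL n) (le_of_lt hx)) (hu.nonneg t ht0.le (hlt t htT) x hx)
      · filter_upwards [ae_restrict_mem measurableSet_Ioi] with x hx
        exact mul_le_mul_of_nonneg_right sig_le_pow (hu.nonneg t ht0.le (hlt t htT) x hx)
    linarith
  have hlb : ∀ n, ∫⁻ q in Dom t, ENNReal.ofReal (F n q) ≤ ENNReal.ofReal (2 * C) := by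
    intro n
    rw [← ofReal_integral_eq_lintegral_ofReal (hFi n)]
    · exact ENNReal.ofReal_le_ofReal (hbound n)
    · filter_upwards [ae_restrict_mem (dom_meas t)] with q hq
      exact hFnn n q hq
  have hfat : ∫⁻ q in Dom t, liminf (fun n => ENNReal.ofReal (F n q)) atTop ≤
      ENNReal.ofReal (2 * C) := by
    refine (lintegral_liminf_le' fun n => (hFm n).ennreal_ofReal).trans ?_
    refine (liminf_le_liminf (Eventually.of_forall hlb)).trans ?_
    simp
  have hae : ∀ᵐ q ∂(volume.restrict (Dom t)),
      liminf (fun n => ENNReal.ofReal (F n q)) atTop < ⊤ := by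
    refine ae_lt_top' ?_ (hfat.trans_lt ENNReal.ofReal_lt_top).ne
    simp only [liminf_eq_iSup_iInf_of_nat]
    exact AEMeasurable.iSup fun n => AEMeasurable.biInf _ (Set.to_countable _)
      fun i _ => (hFm i).ennreal_ofReal
  have hae2 : ∀ᵐ q ∂(volume.restrict (Dom t)), ¬ (0 < u q.1 q.2.1 ∧ 0 < u q.1 q.2.2) := by
    filter_upwards [hae, ae_restrict_mem (dom_meas t)] with q hq hqD hcon
    obtain ⟨hx, hy, h1, h2⟩ := hmemu q hqD
    have hT1 : Tendsto (fun n => F n q) atTop atTop := by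
      simp only [hF]
      refine Tendsto.atTop_mul_const hcon.2 (Tendsto.atTop_mul_const hcon.1
        (Tendsto.atTop_mul_const (phi_pos hx hy) ?_))
      exact ups_tendsto hν hν1 hx hy
    have := (ENNReal.tendsto_ofReal_atTop.comp hT1).liminf_eq
    simp only [Function.comp_def] at this
    rw [this] at hq
    exact lt_irrefl _ hq
  rw [dom_vol] at hae2
  have h1 := Measure.ae_ae_of_ae_prod hae2
  have : (ae (volume.restrict (Ioo (0:ℝ) t))).NeBot := by
    rw [ae_restrict_neBot, Real.volume_Ioo]
    simp [ht0]
  obtain ⟨τ, hτ, hτm⟩ := (h1.and (ae_restrict_mem measurableSet_Ioo)).exists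
  have hτ0 : 0 ≤ τ := hτm.1.le
  have hτT : τ < T := lt_trans hτm.2 htT
  obtain ⟨x, hx0, hx, hux⟩ := hpos τ hτ0 hτT _ (Measure.ae_ae_of_ae_prod hτ)
  obtain ⟨y, hy0, hy, huy⟩ := hpos τ hτ0 hτT _ hx
  exact hy ⟨hux, huy⟩

/-- Non-existence of mass-conserving weak solutions for the power-law
daughter distribution with `ν ∈ (-2,-1]` when `λ₁ < |ν| - 1` and `λ = λ₁ + λ₂ < 1`. -/
theorem nonexistence
    (ν k₀ l₁ l₂ : ℝ) (hν : ν ∈ Ioc (-2:ℝ) (-1))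
    (hk₀ : k₀ ∈ Ioo (|ν| - 1) 1)
    (hl₁₂ : l₁ ≤ l₂) (hl₂ : l₂ ≤ 1) (hl₁ : l₁ < |ν| - 1) (hlam : l₁ + l₂ < 1)
    (uin : ℝ → ℝ) (hmeas : Measurable uin) (hnn : ∀ x : ℝ, 0 ≤ uin x)
    (hXk₀ : MemXk k₀ uin) (hX1k₀ : MemXk (1 + k₀) uin) (hρ : 0 < Mk 1 uin)
    (T : ℝ) (hT : 0 < T) :
    ¬ ∃ u : ℝ → ℝ → ℝ,
        IsWeakSolution k₀ (betaPow ν) (Phi l₁ l₂) uin (ENNReal.ofReal T) u ∧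
        MassConserving uin (ENNReal.ofReal T) u := by
  rintro ⟨u, hu, hm⟩
  have habs : |ν| = -ν := abs_of_neg (by linarith [hν.2])
  rw [habs] at hk₀ hl₁
  exact nonex_core ν k₀ l₁ l₂ hν.1 hν.2 hk₀.1 hk₀.2 hl₁ uin hnn hρ T hT u hu hm

end
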